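/- Let G be an undirected simple graph on [d] with g = |E| ≥ 2 edges. The set N_∞^G := {(δ,ε) ∈ M^G : ‖δ‖_∞ = 1 and (A^{G,δ,ε})^{-1} is not perfect w.r.t. G}, viewed as a subset of ℝ^{g+1}, has g-dimensional Hausdorff measure zero. -/

import Mathlib

open MeasureTheory

/-- `S` separates `A` from `B` in the simple graph `G`: every path from a vertex of `A` to a
vertex of `B` passes through a vertex of `S`. -/
def Separates {d : ℕ} (G : SimpleGraph (Fin d)) (A B S : Set (Fin d)) : Prop :=
  ∀ a ∈ A, ∀ b ∈ B, ∀ p : G.Walk a b, p.IsPath → ∃ c ∈ S, c ∈ p.support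

/-- Determinant of the submatrix of `M` with rows indexed by `{i} ∪ S` and columns
indexed by `{j} ∪ S`. -/
noncomputable def subDet {d : ℕ} (M : Matrix (Fin d) (Fin d) ℝ) (i j : Fin d)
    (S : Finset (Fin d)) : ℝ :=
  (M.submatrix (fun k : Option {x // x ∈ S} => k.elim i Subtype.val)
    (fun k : Option {x // x ∈ S} => k.elim j Subtype.val)).det

/-- A positive definite matrix `M` is perfect w.r.t. `G` if for all distinct `i, j` and all
`S ⊆ [d] \ {i,j}`, `det M_{iS,jS} = 0` iff `S` separates `{i}` from `{j}` in `G`. -/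
def IsPerfect {d : ℕ} (G : SimpleGraph (Fin d)) (M : Matrix (Fin d) (Fin d) ℝ) : Prop :=
  ∀ i j : Fin d, i ≠ j → ∀ S : Finset (Fin d), i ∉ S → j ∉ S →
    (subDet M i j S = 0 ↔ Separates G {i} {j} ↑S)

open Classical in
/-- The matrix `A^{G,δ,ε}`: diagonal entries `1`, entry `δ_{ij}·ε` in position `(i,j)` when
`ij` is an edge of `G`, and `0` otherwise; `η` enumerates the edges of `G`. -/
noncomputable def AGde {d g : ℕ} (G : SimpleGraph (Fin d)) (η : Fin g ≃ G.edgeSet)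
    (δ : Fin g → ℝ) (ε : ℝ) : Matrix (Fin d) (Fin d) ℝ :=
  fun i j => if i = j then 1 else
    if h : G.Adj i j then δ (η.symm ⟨s(i,j), h⟩) * ε else 0

/-- `ε_G(δ) = sup {ε > 0 : A^{G,δ,ε} is positive definite}` (a real supremum; the set is
nonempty and bounded above whenever all entries of `δ` are nonzero). -/
noncomputable def epsG {d g : ℕ} (G : SimpleGraph (Fin d)) (η : Fin g ≃ G.edgeSet)
    (δ : Fin g → ℝ) : ℝ :=
  sSup {ε : ℝ | 0 < ε ∧ (AGde G η δ ε).PosDef}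

section NullSets

/-- The zero set of a nonzero real polynomial in finitely many variables is Lebesgue null. -/
theorem MvPolynomial.volume_zeros_eq_zero {n : ℕ} (p : MvPolynomial (Fin n) ℝ) (hp : p ≠ 0) :
    volume {x : Fin n → ℝ | MvPolynomial.eval x p = 0} = 0 := by
  induction n with
  | zero =>
    have h : {x : Fin 0 → ℝ | MvPolynomial.eval x p = 0} = ∅ := by
      refine Set.eq_empty_of_forall_notMem fun x hx => hp (MvPolynomial.funext fun y => ?_)
      rw [Subsingleton.elim y x, map_zero]
      exact hx
    rw [h, measure_empty]
  | succ n ih =>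
    have hmeas : MeasurableSet {x : Fin (n + 1) → ℝ | MvPolynomial.eval x p = 0} :=
      (isClosed_eq (MvPolynomial.continuous_eval p) continuous_const).measurableSet
    have hmp := (volume_preserving_piFinSuccAbove (fun _ : Fin (n + 1) => ℝ) 0).symm
    rw [← hmp.measure_preimage hmeas.nullMeasurableSet, Measure.volume_eq_prod,
      Measure.measure_prod_null (hmp.measurable hmeas)]
    set q := MvPolynomial.finSuccEquiv ℝ n p with hq
    have hq0 : q ≠ 0 := by simpa [hq] using hp
    have hfin : {a : ℝ | q.eval (MvPolynomial.C a) = 0}.Finite := by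
      have h := (Polynomial.finite_setOfPred_isRoot hq0).preimage
        (f := (MvPolynomial.C : ℝ →+* MvPolynomial (Fin n) ℝ))
        (MvPolynomial.C_injective (Fin n) ℝ).injOn
      exact h
    have hae : ∀ᵐ a : ℝ, q.eval (MvPolynomial.C a) ≠ 0 :=
      measure_eq_zero_iff_ae_notMem.mp (hfin.measure_zero volume)
    filter_upwards [hae] with a ha
    refine (congrArg volume ?_).trans (ih _ ha)
    ext y
    have h : MvPolynomial.eval (Fin.cons a y) p =
        MvPolynomial.eval y (q.eval (MvPolynomial.C a)) := by
      rw [MvPolynomial.eval_eq_eval_mv_eval', ← hq, Polynomial.eval_map,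
        ← Polynomial.eval₂_hom, MvPolynomial.eval_C]
    simp only [Set.mem_preimage, Set.mem_ofPred_eq, ← h]
    rw [MeasurableEquiv.piFinSuccAbove_symm_apply, Fin.insertNthEquiv_zero]
    rfl

/-- Polar coordinates `x ↦ (x / ‖x‖, ‖x‖)` are Lipschitz away from the origin. -/
theorem lipschitzOnWith_polar {E : Type*} [NormedAddCommGroup E] [NormedSpace ℝ E] (n : ℕ) :
    LipschitzOnWith (2 * (n + 1)) (fun x : E => (‖x‖⁻¹ • x, ‖x‖))
      {x : E | 1 / ((n : ℝ) + 1) ≤ ‖x‖} := by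
  refine LipschitzOnWith.of_dist_le_mul fun x hx y hy => ?_
  simp only [Set.mem_ofPred_eq] at hx hy
  have hn : (0 : ℝ) < 1 / ((n : ℝ) + 1) := by positivity
  have hx0 : 0 < ‖x‖ := hn.trans_le hx
  have hy0 : 0 < ‖y‖ := hn.trans_le hy
  have hinv : ‖x‖⁻¹ ≤ (n : ℝ) + 1 := by
    rw [inv_le_comm₀ hx0 (by positivity), ← one_div]
    exact hx
  have hsub : |‖y‖ - ‖x‖| ≤ ‖x - y‖ := by
    rw [norm_sub_rev]
    exact abs_norm_sub_norm_le y x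
  have hn0 : (0 : ℝ) ≤ n := n.cast_nonneg
  push_cast
  rw [Prod.dist_eq, max_le_iff]
  constructor
  · have hdecomp : ‖x‖⁻¹ • x - ‖y‖⁻¹ • y =
        ‖x‖⁻¹ • (x - y) + (‖x‖⁻¹ * (‖y‖ - ‖x‖) * ‖y‖⁻¹) • y := by
      have h : ‖x‖⁻¹ * (‖y‖ - ‖x‖) * ‖y‖⁻¹ = ‖x‖⁻¹ - ‖y‖⁻¹ := by field_simp
      rw [h]
      module
    have hsnd : ‖(‖x‖⁻¹ * (‖y‖ - ‖x‖) * ‖y‖⁻¹) • y‖ = ‖x‖⁻¹ * |‖y‖ - ‖x‖| := by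
      rw [norm_smul, norm_mul, norm_mul, norm_inv, norm_inv, norm_norm, norm_norm,
        Real.norm_eq_abs, mul_assoc, inv_mul_cancel₀ hy0.ne', mul_one]
    simp only [dist_eq_norm]
    rw [hdecomp]
    calc _ ≤ ‖‖x‖⁻¹ • (x - y)‖ + ‖(‖x‖⁻¹ * (‖y‖ - ‖x‖) * ‖y‖⁻¹) • y‖ := norm_add_le _ _
      _ = ‖x‖⁻¹ * ‖x - y‖ + ‖x‖⁻¹ * |‖y‖ - ‖x‖| := by
        rw [hsnd, norm_smul, norm_inv, norm_norm]
      _ ≤ ((n : ℝ) + 1) * ‖x - y‖ + ((n : ℝ) + 1) * ‖x - y‖ := by gcongr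
      _ = 2 * ((n : ℝ) + 1) * ‖x - y‖ := by ring
  · rw [Real.dist_eq, dist_eq_norm]
    refine (abs_norm_sub_norm_le x y).trans (le_mul_of_one_le_left (norm_nonneg _) ?_)
    linarith

/-- A subset of the cylinder over the unit sphere has zero Hausdorff measure as soon as it maps
into a null set under `(u, r) ↦ r • u`. -/
theorem hausdorffMeasure_polar_preimage_eq_zero {E : Type*} [NormedAddCommGroup E]
    [NormedSpace ℝ E] [MeasurableSpace E] [BorelSpace E] [SecondCountableTopology E]
    {s : ℝ} (hs : 0 ≤ s) {N : Set E} (hN : μH[s] N = 0) :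
    μH[s] {p : E × ℝ | ‖p.1‖ = 1 ∧ 0 < p.2 ∧ p.2 • p.1 ∈ N} = 0 := by
  have hcover : {p : E × ℝ | ‖p.1‖ = 1 ∧ 0 < p.2 ∧ p.2 • p.1 ∈ N} ⊆
      ⋃ n : ℕ, (fun x : E => (‖x‖⁻¹ • x, ‖x‖)) '' (N ∩ {x | 1 / ((n : ℝ) + 1) ≤ ‖x‖}) := by
    rintro ⟨u, r⟩ ⟨hu, hr, hmem⟩
    simp only at hu hr hmem
    obtain ⟨n, hn⟩ := exists_nat_one_div_lt hr
    have hnorm : ‖r • u‖ = r := by rw [norm_smul, hu, mul_one, Real.norm_of_nonneg hr.le]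
    refine Set.mem_iUnion.mpr ⟨n, r • u, ⟨hmem, ?_⟩, ?_⟩
    · simpa only [Set.mem_ofPred_eq, hnorm] using hn.le
    · simp only [hnorm, smul_smul, inv_mul_cancel₀ hr.ne', one_smul]
  refine measure_mono_null hcover (measure_iUnion_null fun n => ?_)
  have h := ((lipschitzOnWith_polar (E := E) n).mono
    (Set.inter_subset_right (s := N))).hausdorffMeasure_image_le hs
  rw [measure_mono_null Set.inter_subset_left hN, mul_zero] at h
  exact le_antisymm h zero_le

end NullSets

section Minors

variable {m n K : Type*} [Fintype m] [DecidableEq m] [Fintype n] [Field K]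

/-- A minor of `M` vanishes iff `M` sends a nonzero vector supported on the selected columns to a
vector vanishing on the selected rows. -/
theorem Matrix.det_submatrix_eq_zero_iff (M : Matrix n n K) (r c : m → n)
    (hc : Function.Injective c) :
    (M.submatrix r c).det = 0 ↔
      ∃ w : n → K, w ≠ 0 ∧ (∀ k ∉ Set.range c, w k = 0) ∧ ∀ o, (M.mulVec w) (r o) = 0 := by
  have key : ∀ w : n → K, (∀ k ∉ Set.range c, w k = 0) →
      ∀ o, ((M.submatrix r c).mulVec (w ∘ c)) o = (M.mulVec w) (r o) := by
    intro w hw o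
    simp only [Matrix.mulVec, dotProduct]
    exact Fintype.sum_of_injective c hc _ _ (fun k hk => by simp [hw k hk]) fun _ => rfl
  rw [← Matrix.exists_mulVec_eq_zero_iff]
  constructor
  · rintro ⟨u, hu, hMu⟩
    have hcomp : Function.extend c u 0 ∘ c = u := funext fun o => hc.extend_apply u 0 o
    have hsupp : ∀ k ∉ Set.range c, Function.extend c u 0 k = 0 := fun k hk =>
      Function.extend_apply' _ _ _ hk
    refine ⟨Function.extend c u 0, fun h => hu ?_, hsupp, fun o => ?_⟩
    · rw [← hcomp, h]
      rfl
    · rw [← key _ hsupp, hcomp, hMu, Pi.zero_apply]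
  · rintro ⟨w, hw, hsupp, hMw⟩
    refine ⟨w ∘ c, fun h => hw (funext fun k => ?_), funext fun o => ?_⟩
    · by_cases hk : k ∈ Set.range c
      · obtain ⟨o, rfl⟩ := hk
        exact congrFun h o
      · exact hsupp k hk
    · rw [key w hsupp, hMw, Pi.zero_apply]

end Minors

/-- Vanishing of the minor `iS, jS` of `A⁻¹`, expressed in terms of `A`. -/
theorem subDet_inv_eq_zero_iff {d : ℕ} {A : Matrix (Fin d) (Fin d) ℝ} (hA : IsUnit A.det)
    (i j : Fin d) (S : Finset (Fin d)) (hj : j ∉ S) :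
    subDet A⁻¹ i j S = 0 ↔ ∃ v : Fin d → ℝ, v ≠ 0 ∧ v i = 0 ∧ (∀ k ∈ S, v k = 0) ∧
      ∀ k, k ≠ j → k ∉ S → (A.mulVec v) k = 0 := by
  have hc : Function.Injective
      (fun k : Option {x // x ∈ S} => k.elim j Subtype.val) := by
    rintro (_ | ⟨a, ha⟩) (_ | ⟨b, hb⟩) h
    · rfl
    · exact absurd (show j = b from h) fun h => hj (h ▸ hb)
    · exact absurd (show a = j from h) fun h => hj (h ▸ ha)
    · simpa using h
  have hrange : ∀ k, k ∉ Set.range (fun k : Option {x // x ∈ S} => k.elim j Subtype.val) ↔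
      k ≠ j ∧ k ∉ S := by
    intro k
    simp [Option.exists, eq_comm]
  rw [subDet, Matrix.det_submatrix_eq_zero_iff _ _ _ hc]
  simp only [hrange, Option.forall, Option.elim_none, Option.elim_some, Subtype.forall]
  constructor
  · rintro ⟨w, hw, hsupp, hi, hS⟩
    have hAw : A.mulVec (A⁻¹.mulVec w) = w := by
      rw [Matrix.mulVec_mulVec, Matrix.mul_nonsing_inv A hA, Matrix.one_mulVec]
    refine ⟨A⁻¹.mulVec w, fun h => hw ?_, hi, hS, fun k hkj hkS => ?_⟩
    · rw [← hAw, h, Matrix.mulVec_zero]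
    · rw [hAw, hsupp k ⟨hkj, hkS⟩]
  · rintro ⟨v, hv, hi, hS, hsupp⟩
    have hAv : A⁻¹.mulVec (A.mulVec v) = v := by
      rw [Matrix.mulVec_mulVec, Matrix.nonsing_inv_mul A hA, Matrix.one_mulVec]
    refine ⟨A.mulVec v, fun h => hv ?_, fun k hk => hsupp k hk.1 hk.2, ?_, fun k hk => ?_⟩
    · rw [← hAv, h, Matrix.mulVec_zero]
    · rw [hAv, hi]
    · rw [hAv, hS k hk]

section Separation

variable {d : ℕ} {G : SimpleGraph (Fin d)}

/-- If `A` is supported on `G` and `S` separates `i` from `j`, the minor `iS, jS` of `A⁻¹`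
vanishes. -/
theorem subDet_inv_eq_zero_of_separates {A : Matrix (Fin d) (Fin d) ℝ} (hA : IsUnit A.det)
    (hAG : ∀ a b, a ≠ b → ¬ G.Adj a b → A a b = 0) {i j : Fin d} {S : Finset (Fin d)}
    (hj : j ∉ S) (hsep : Separates G {i} {j} ↑S) : subDet A⁻¹ i j S = 0 := by
  classical
  rw [subDet_inv_eq_zero_iff hA i j S hj]
  set C : Set (Fin d) := {k | ∃ p : G.Walk k j, ∀ c ∈ p.support, c ∉ S} with hC
  have hjC : j ∈ C := ⟨.nil, by simpa using hj⟩
  have hCS : ∀ k ∈ C, k ∉ S := fun k ⟨p, hp⟩ => hp k p.start_mem_support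
  have hiC : i ∉ C := by
    rintro ⟨p, hp⟩
    obtain ⟨c, hcS, hc⟩ := hsep i rfl j rfl p.bypass p.bypass_isPath
    exact hp c (p.support_bypass_subset_support hc) hcS
  have hadj : ∀ a b, b ∈ C → G.Adj a b → a ∉ S → a ∈ C := by
    rintro a b ⟨p, hp⟩ hab haS
    refine ⟨.cons hab p, ?_⟩
    simpa [SimpleGraph.Walk.support_cons] using ⟨haS, hp⟩
  let L : (C → ℝ) →ₗ[ℝ] ({k : C // k ≠ ⟨j, hjC⟩} → ℝ) :=
    Matrix.mulVecLin (Matrix.of fun a b => A a.1 b)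
  have hL : LinearMap.ker L ≠ ⊥ := by
    refine L.ker_ne_bot_of_finrank_lt ?_
    rw [Module.finrank_fintype_fun_eq_card, Module.finrank_fintype_fun_eq_card]
    exact Fintype.card_subtype_lt (x := ⟨j, hjC⟩) (by simp)
  obtain ⟨u, huL, hu⟩ := (Submodule.ne_bot_iff _).mp hL
  let v : Fin d → ℝ := fun k => if h : k ∈ C then u ⟨k, h⟩ else 0
  have hv : ∀ k ∉ C, v k = 0 := fun k hk => dif_neg hk
  have hvC : ∀ k : C, v k = u k := fun k => dif_pos k.2
  refine ⟨v, fun h => hu (funext fun k => ?_), hv i hiC, fun k hk => hv k fun h => hCS k h hk,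
    fun k hkj hkS => ?_⟩
  · rw [← hvC, h]
    rfl
  · by_cases hk : k ∈ C
    · have h := congrFun (LinearMap.mem_ker.mp huL) ⟨⟨k, hk⟩, fun h => hkj (congrArg Subtype.val h)⟩
      refine Eq.trans (Eq.symm ?_) h
      exact Fintype.sum_of_injective (Subtype.val : C → Fin d) Subtype.val_injective _ _
        (fun b hb => by rw [hv b (by simpa using hb), mul_zero]) fun b => by rw [hvC]; rfl
    · rw [Matrix.mulVec, dotProduct]
      refine Finset.sum_eq_zero fun b _ => ?_
      by_cases hb : b ∈ C
      · rw [hAG k b (fun h => hk (h ▸ hb)) fun h => hk (hadj k b hb h hkS), zero_mul]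
      · rw [hv b hb, mul_zero]

/-- A vector vanishing at the start of a path and annihilated by all rows of `1 + t • B` except
the last, `B` being the adjacency matrix of the path, vanishes on the path. -/
theorem eq_zero_on_path {t : ℝ} (ht : t ≠ 0) {v : Fin d → ℝ} {i j : Fin d} (p : G.Walk i j)
    (hp : p.IsPath) (hi : v i = 0)
    (hrow : ∀ u ∈ p.support, u ≠ j →
      v u + t * ∑ k, (if s(u, k) ∈ p.edges then v k else 0) = 0) :
    ∀ u ∈ p.support, v u = 0 := by
  induction p with
  | nil => simpa using hi
  | @cons a b c h p ih =>
    rw [SimpleGraph.Walk.cons_isPath_iff] at hp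
    obtain ⟨hp, ha⟩ := hp
    have hedge : ∀ k, s(a, k) ∉ p.edges := fun k hk => ha (p.fst_mem_support_of_mem_edges hk)
    have hb : v b = 0 := by
      have h' := hrow a (by simp) fun h => ha (h ▸ p.end_mem_support)
      have hsum : ∑ k, (if s(a, k) ∈ (SimpleGraph.Walk.cons h p).edges then v k else 0) = v b := by
        rw [Finset.sum_eq_single b]
        · simp
        · intro k _ hk
          rw [if_neg]
          simp [SimpleGraph.Walk.edges_cons, hedge, hk, h.ne]
        · simp
      rw [hsum, hi, zero_add] at h'
      exact (mul_eq_zero.mp h').resolve_left ht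
    have hrest := ih hp hb fun u hu huc => by
      refine Eq.trans ?_ (hrow u (by simp [hu]) huc)
      congr 2
      refine Finset.sum_congr rfl fun k _ => ?_
      by_cases hk : s(u, k) = s(a, b)
      · rcases Sym2.eq_iff.mp hk with ⟨rfl, -⟩ | ⟨-, rfl⟩
        · exact absurd hu ha
        · simp [hi]
      · simp [SimpleGraph.Walk.edges_cons, hk]
    intro u hu
    rcases List.mem_cons.mp (SimpleGraph.Walk.support_cons h p ▸ hu) with rfl | hu
    · exact hi
    · exact hrest u hu

end Separation

section Generic

variable {d g : ℕ} (G : SimpleGraph (Fin d)) (η : Fin g ≃ G.edgeSet)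

theorem AGde_eq_smul (δ : Fin g → ℝ) (ε : ℝ) : AGde G η δ ε = AGde G η (ε • δ) 1 := by
  ext a b
  simp [AGde, mul_comm]

theorem AGde_eq_zero_of_not_adj (δ : Fin g → ℝ) (ε : ℝ) {a b : Fin d} (hab : a ≠ b)
    (h : ¬ G.Adj a b) : AGde G η δ ε a b = 0 := by
  simp [AGde, hab, h]

open Classical in
/-- The matrix `A^{G,x,1}` with indeterminate entries `x`. -/
noncomputable def genericMatrix : Matrix (Fin d) (Fin d) (MvPolynomial (Fin g) ℝ) :=
  fun a b => if a = b then 1 else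
    if h : G.Adj a b then MvPolynomial.X (η.symm ⟨s(a, b), h⟩) else 0

theorem map_eval_genericMatrix (x : Fin g → ℝ) :
    (genericMatrix G η).map (MvPolynomial.eval x) = AGde G η x 1 := by
  ext a b
  simp only [genericMatrix, AGde, Matrix.map_apply]
  split_ifs <;> simp

theorem eval_det_genericMatrix (x : Fin g → ℝ) :
    MvPolynomial.eval x (genericMatrix G η).det = (AGde G η x 1).det := by
  rw [RingHom.map_det, RingHom.mapMatrix_apply, map_eval_genericMatrix]

/-- The minor `iS, jS` of the adjugate of the generic matrix. -/
noncomputable def genericMinor (i j : Fin d) (S : Finset (Fin d)) : MvPolynomial (Fin g) ℝ :=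
  ((genericMatrix G η).adjugate.submatrix
    (fun k : Option {x // x ∈ S} => k.elim i Subtype.val)
    (fun k : Option {x // x ∈ S} => k.elim j Subtype.val)).det

theorem eval_genericMinor (x : Fin g → ℝ) (i j : Fin d) (S : Finset (Fin d)) :
    MvPolynomial.eval x (genericMinor G η i j S) = subDet (AGde G η x 1).adjugate i j S := by
  rw [genericMinor, RingHom.map_det, subDet, ← map_eval_genericMatrix, ← RingHom.mapMatrix_apply,
    ← RingHom.map_adjugate]
  rfl

theorem subDet_inv_eq_zero_iff_adjugate {A : Matrix (Fin d) (Fin d) ℝ} (hA : IsUnit A.det)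
    (i j : Fin d) (S : Finset (Fin d)) :
    subDet A⁻¹ i j S = 0 ↔ subDet A.adjugate i j S = 0 := by
  rw [subDet, Matrix.inv_def, Matrix.submatrix_smul, Pi.smul_apply, Pi.smul_apply,
    Matrix.det_smul, Ring.inverse_eq_inv, mul_eq_zero, subDet]
  exact or_iff_right (pow_ne_zero _ (inv_ne_zero hA.ne_zero))

variable {G}

/-- If `S` does not separate `i` from `j`, the minor `iS, jS` of the inverse is nonzero for some
choice of the edge weights. -/
theorem exists_subDet_inv_ne_zero {i j : Fin d} {S : Finset (Fin d)} (hj : j ∉ S)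
    (hsep : ¬ Separates G {i} {j} ↑S) :
    ∃ x : Fin g → ℝ, IsUnit (AGde G η x 1).det ∧ subDet (AGde G η x 1)⁻¹ i j S ≠ 0 := by
  classical
  simp only [Separates, Set.mem_singleton_iff, forall_eq, not_forall, not_exists, not_and,
    Finset.mem_coe] at hsep
  obtain ⟨p, hp, hpS⟩ := hsep
  let x : ℝ → Fin g → ℝ := fun t k => if (η k : Sym2 (Fin d)) ∈ p.edges then t else 0
  have hentry : ∀ t a b, AGde G η (x t) 1 a b =
      (if a = b then 1 else 0) + t * if s(a, b) ∈ p.edges then 1 else 0 := by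
    intro t a b
    by_cases hab : a = b
    · subst hab
      have : s(a, a) ∉ p.edges := fun h => G.loopless.irrefl a (p.adj_of_mem_edges h)
      simp [AGde, this]
    · by_cases h : G.Adj a b
      · simp [AGde, hab, h, x]
      · have : s(a, b) ∉ p.edges := fun h' => h (p.adj_of_mem_edges h')
        simp [AGde, hab, h, this]
  have hmul : ∀ t (v : Fin d → ℝ) u, ((AGde G η (x t) 1).mulVec v) u =
      v u + t * ∑ k, if s(u, k) ∈ p.edges then v k else 0 := by
    intro t v u
    simp [Matrix.mulVec, dotProduct, hentry, add_mul, Finset.sum_add_distrib, Finset.mul_sum]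
  have hcont : Continuous fun t => (AGde G η (x t) 1).det := by
    refine Continuous.matrix_det (continuous_matrix fun a b => ?_)
    simp only [hentry]
    fun_prop
  have hone : (AGde G η (x 0) 1).det ≠ 0 := by
    have h : AGde G η (x 0) 1 = 1 := by
      ext a b
      rw [hentry, zero_mul, add_zero, Matrix.one_apply]
    rw [h, Matrix.det_one]
    exact one_ne_zero
  obtain ⟨t, htdet, ht⟩ := (((hcont.continuousAt.eventually_ne hone).filter_mono
    nhdsWithin_le_nhds).and (self_mem_nhdsWithin (s := {(0 : ℝ)}ᶜ))).exists
  refine ⟨x t, isUnit_iff_ne_zero.mpr htdet, fun h => ?_⟩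
  obtain ⟨v, hv, hvi, hvS, hrow⟩ :=
    (subDet_inv_eq_zero_iff (isUnit_iff_ne_zero.mpr htdet) i j S hj).mp h
  simp only [hmul] at hrow
  have hpath := eq_zero_on_path ht p hp hvi fun u hu huj =>
    hrow u huj fun huS => hpS u huS hu
  refine hv (funext fun u => ?_)
  by_cases hu : u ∈ p.support
  · exact hpath u hu
  by_cases huS : u ∈ S
  · exact hvS u huS
  have hsum : ∑ k, (if s(u, k) ∈ p.edges then v k else 0) = 0 :=
    Finset.sum_eq_zero fun k _ => if_neg fun hk => hu (p.fst_mem_support_of_mem_edges hk)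
  simpa [hsum] using hrow u (fun h => hu (h ▸ p.end_mem_support)) huS

/-- For almost all edge weights the inverse of `A^{G,x,1}` is perfect. -/
theorem ae_isPerfect_inv : ∀ᵐ x : Fin g → ℝ, IsPerfect G (AGde G η x 1)⁻¹ := by
  have hae : ∀ q : MvPolynomial (Fin g) ℝ, q ≠ 0 →
      ∀ᵐ x : Fin g → ℝ, MvPolynomial.eval x q ≠ 0 := fun q hq =>
    measure_eq_zero_iff_ae_notMem.mp (q.volume_zeros_eq_zero hq)
  have hdet : (genericMatrix G η).det ≠ 0 := fun h => by
    have hone : AGde G η 0 1 = 1 := by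
      ext a b
      simp [AGde, Matrix.one_apply]
    simpa [h, hone] using eval_det_genericMatrix G η 0
  have hminor : ∀ᵐ x : Fin g → ℝ, ∀ (i j : Fin d) (S : Finset (Fin d)),
      genericMinor G η i j S ≠ 0 → MvPolynomial.eval x (genericMinor G η i j S) ≠ 0 := by
    simp only [Filter.eventually_all]
    exact fun i j S h => hae _ h
  filter_upwards [hae _ hdet, hminor] with x hx hxm i j _ S _ hj
  rw [eval_det_genericMatrix] at hx
  have hA : IsUnit (AGde G η x 1).det := isUnit_iff_ne_zero.mpr hx
  refine ⟨fun h => ?_, fun h => subDet_inv_eq_zero_of_separates hA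
    (fun a b => AGde_eq_zero_of_not_adj G η x 1) hj h⟩
  by_contra hsep
  obtain ⟨y, hy, hy0⟩ := exists_subDet_inv_ne_zero η hj hsep
  refine hxm i j S (fun h0 => hy0 ?_) ?_
  · rw [subDet_inv_eq_zero_iff_adjugate hy, ← eval_genericMinor, h0, map_zero]
  · rwa [eval_genericMinor, ← subDet_inv_eq_zero_iff_adjugate hA]

end Generic

/-- for a simple graph `G` on `[d]` with `g ≥ 2` edges (enumerated by `η`), the
set `N_∞^G = {(δ,ε) ∈ M^G : ‖δ‖_∞ = 1, (A^{G,δ,ε})⁻¹ is not perfect w.r.t. G}`, with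
`M^G = {(δ,ε) : δ ∈ [-1,1]_*^E, 0 < ε < ε_G(δ)}` viewed as a subset of `ℝ^g × ℝ ≅ ℝ^{g+1}`,
has `g`-dimensional Hausdorff measure zero. -/
theorem statement6 {d g : ℕ} (G : SimpleGraph (Fin d)) (η : Fin g ≃ G.edgeSet) (hg : 2 ≤ g) :
    μH[(g : ℝ)] {p : (Fin g → ℝ) × ℝ |
      (∀ k, p.1 k ∈ Set.Icc (-1 : ℝ) 1 ∧ p.1 k ≠ 0) ∧ ‖p.1‖ = 1 ∧
      0 < p.2 ∧ p.2 < epsG G η p.1 ∧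
      ¬ IsPerfect G ((AGde G η p.1 p.2)⁻¹)} = 0 := by
  have hnull : μH[(g : ℝ)] {x : Fin g → ℝ | ¬ IsPerfect G (AGde G η x 1)⁻¹} = 0 := by
    have h := hausdorffMeasure_pi_real (ι := Fin g)
    rw [Fintype.card_fin] at h
    rw [h]
    exact ae_isPerfect_inv η
  refine measure_mono_null ?_
    (hausdorffMeasure_polar_preimage_eq_zero g.cast_nonneg hnull)
  rintro ⟨δ, ε⟩ ⟨-, hδ, hε, -, hperf⟩
  refine ⟨hδ, hε, ?_⟩
  rwa [AGde_eq_smul] at hperf
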